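/- arXiv:2107.05351 — 3 statements merged into one kernel-verified Lean document; each statement's English description precedes it below -/
import Mathlib

section
/- Suppose the infimum ρ* defining the stability-driven clustering value is attained by some cluster assignment g* : {1,…,K} → {1,…,L} and cost vectors c^{1*},…,c^{L*} ∈ ℝⁿ with ‖c^{ℓ*}‖₁ = 1 for all ℓ. Then for every k ∈ {1,…,K} there exist a point x^{k*} ∈ X^{k*}(c^{g*(k)*}) with ‖x̂^k − x^{k*}‖ = max{‖x̂^k − x‖ : x ∈ X^{k*}(c^{g*(k)*})} and an index set I^{k*} ⊆ {1,…,m_k} with |I^{k*}| = n such that (i) a^{ki}·x^{k*} = b^k_i for every i ∈ I^{k*}, and (ii) c^{g*(k)*} lies in the conic hull cone({a^{ki} : i ∈ I^{k*}}), i.e. c^{g*(k)*} = Σ_{i∈I^{k*}} γ_i a^{ki} for some coefficients γ_i ≥ 0. In other words, the SC problem admits an optimal solution in which every x^{k*} lies on n tight constraints of its polyhedron and every cluster cost vector is a conic combination of those tight constraint rows. -/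
/- Theorem 1 of the paper (solution structure of the SC model). -/

open scoped Matrix BigOperators

/-- Feasible set `{x : A x ≥ b}` of a linear program given by the rows `a i` of `A`. -/
def Feas {n m : ℕ} (a : Fin m → Fin n → ℝ) (b : Fin m → ℝ) : Set (Fin n → ℝ) :=
  {x | ∀ i, b i ≤ a i ⬝ᵥ x}

/-- Optimal-solution set `X*(c) = argmin {c·x : A x ≥ b}`. -/
def OptSet {n m : ℕ} (a : Fin m → Fin n → ℝ) (b : Fin m → ℝ) (c : Fin n → ℝ) :
    Set (Fin n → ℝ) :=
  {x ∈ Feas a b | ∀ y ∈ Feas a b, c ⬝ᵥ x ≤ c ⬝ᵥ y}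

/-- Worst-case distance `W(g,c)` of a cluster assignment `g` and cost vectors `c`, where the
distance is measured by the norm `N` on `ℝⁿ`. -/
noncomputable def WDist {n K L : ℕ} {m : Fin K → ℕ} (N : Seminorm ℝ (Fin n → ℝ))
    (a : (k : Fin K) → Fin (m k) → Fin n → ℝ) (b : (k : Fin K) → Fin (m k) → ℝ)
    (xhat : Fin K → Fin n → ℝ) (g : Fin K → Fin L) (c : Fin L → Fin n → ℝ) : ℝ :=
  ⨆ k : Fin K, sSup ((fun x => N (xhat k - x)) '' OptSet (a k) (b k) (c (g k)))

/-- The stability-driven clustering (SC) optimal value `ρ*`. -/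
noncomputable def SCval {n : ℕ} (K L : ℕ) {m : Fin K → ℕ} (N : Seminorm ℝ (Fin n → ℝ))
    (a : (k : Fin K) → Fin (m k) → Fin n → ℝ) (b : (k : Fin K) → Fin (m k) → ℝ)
    (xhat : Fin K → Fin n → ℝ) : ℝ :=
  sInf {r : ℝ | ∃ (g : Fin K → Fin L) (c : Fin L → Fin n → ℝ),
    (∀ ℓ, ∑ j, |c ℓ j| = 1) ∧ r = WDist N a b xhat g c}


lemma sc_carath {ι E : Type*} [DecidableEq ι] [AddCommGroup E] [Module ℝ E] (v : ι → E) (x : E) :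
    ∀ (T : Finset ι) (γ : ι → ℝ), (∀ i, 0 ≤ γ i) → x = ∑ i ∈ T, γ i • v i →
      ∃ J : Finset ι, J ⊆ T ∧ LinearIndepOn ℝ v (J : Set ι) ∧
        ∃ δ : ι → ℝ, (∀ i, 0 ≤ δ i) ∧ x = ∑ i ∈ J, δ i • v i := by
  intro T
  induction T using Finset.strongInduction with
  | H T ih =>
    intro γ hγ hx
    by_cases hT : LinearIndepOn ℝ v (T : Set ι)
    · exact ⟨T, subset_rfl, hT, γ, hγ, hx⟩
    · have h1 : ∃ g : ι → ℝ, ∑ i ∈ T, g i • v i = 0 ∧ ∃ i ∈ T, 0 < g i := by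
        rw [linearIndepOn_finset_iff] at hT
        push Not at hT
        obtain ⟨g, hg, i, hi, hgi⟩ := hT
        rcases lt_or_gt_of_ne hgi with h | h
        · refine ⟨fun i => - g i, ?_, i, hi, by simpa using h⟩
          simp [hg]
        · exact ⟨g, hg, i, hi, h⟩
      obtain ⟨g, hg, j, hj, hgj⟩ := h1
      obtain ⟨i0, hi0, hmin⟩ := Finset.exists_min_image (T.filter (fun i => 0 < g i))
        (fun i => γ i / g i) ⟨j, by simp [hj, hgj]⟩
      simp only [Finset.mem_filter] at hi0 hmin
      obtain ⟨hi0T, hgi0⟩ := hi0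
      set t := γ i0 / g i0 with ht
      have ht0 : 0 ≤ t := div_nonneg (hγ _) hgi0.le
      have hz : γ i0 - t * g i0 = 0 := by rw [ht]; field_simp; ring
      have hnn : ∀ i ∈ T, 0 ≤ γ i - t * g i := by
        intro i hi
        by_cases h : 0 < g i
        · have := hmin i ⟨hi, h⟩
          rw [le_div_iff₀ h] at this
          linarith
        · have : t * g i ≤ 0 := mul_nonpos_of_nonneg_of_nonpos ht0 (not_lt.1 h)
          linarith [hγ i]
      obtain ⟨J, hJ, hli, δ, hδ, hxx⟩ := ih (T.erase i0) (Finset.erase_ssubset hi0T)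
        (fun i => max 0 (γ i - t * g i)) (fun i => le_max_left _ _) (by
          have e1 : ∑ i ∈ T, (γ i - t * g i) • v i = x := by
            simp only [sub_smul, mul_smul, Finset.sum_sub_distrib, ← Finset.smul_sum, hg, ← hx]
            simp
          rw [← e1, ← Finset.add_sum_erase T _ hi0T, hz, zero_smul, zero_add]
          refine Finset.sum_congr rfl fun i hi => ?_
          rw [max_eq_right (hnn i (Finset.mem_of_mem_erase hi))])
      exact ⟨J, hJ.trans (Finset.erase_subset _ _), hli, δ, hδ, hxx⟩

def scCone {n m : ℕ} (v : Fin m → Fin n → ℝ) (T : Finset (Fin m)) : Set (Fin n → ℝ) :=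
  {x | ∃ γ : Fin m → ℝ, (∀ i, 0 ≤ γ i) ∧ x = ∑ i ∈ T, γ i • v i}

lemma scCone_closed_of_li {n m : ℕ} (v : Fin m → Fin n → ℝ) (J : Finset (Fin m))
    (h : LinearIndepOn ℝ v (J : Set (Fin m))) : IsClosed (scCone v J) := by
  have hinj : LinearMap.ker (Fintype.linearCombination ℝ (fun i : J => v i)) = ⊥ :=
    by
    rw [LinearMap.ker_eq_bot']
    intro g hg
    rw [Fintype.linearCombination_apply] at hg
    exact funext (Fintype.linearIndependent_iff.1 h g hg)
  have hc := LinearMap.isClosedEmbedding_of_injective hinj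
  have : scCone v J = (Fintype.linearCombination ℝ (fun i : J => v i)) '' {g | ∀ i, 0 ≤ g i} := by
    ext x
    constructor
    · rintro ⟨γ, hγ, rfl⟩
      refine ⟨fun i => γ i, fun i => hγ i, ?_⟩
      rw [Fintype.linearCombination_apply]
      exact Finset.sum_coe_sort J (fun i => γ i • v i)
    · rintro ⟨g, hg, rfl⟩
      refine ⟨fun i => if hi : i ∈ J then g ⟨i, hi⟩ else 0, fun i => ?_, ?_⟩
      · dsimp only
        split_ifs
        · exact hg _
        · exact le_rfl
      · rw [Fintype.linearCombination_apply, ← Finset.sum_coe_sort J]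
        refine Finset.sum_congr rfl fun i _ => ?_
        simp
  rw [this]
  apply hc.isClosedMap
  simp only [Set.setOf_forall]
  exact isClosed_iInter fun i => isClosed_le continuous_const (continuous_apply i)

lemma scCone_closed {n m : ℕ} (v : Fin m → Fin n → ℝ) (T : Finset (Fin m)) :
    IsClosed (scCone v T) := by
  have : scCone v T = ⋃ J ∈ {J : Finset (Fin m) | J ⊆ T ∧ LinearIndepOn ℝ v (J : Set (Fin m))},
      scCone v J := by
    ext x
    simp only [Set.mem_iUnion, Set.mem_setOf_eq]
    constructor
    · rintro ⟨γ, hγ, hx⟩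
      obtain ⟨J, hJ, hl, δ, hδ, h⟩ := sc_carath v x T γ hγ hx
      exact ⟨J, ⟨hJ, hl⟩, δ, hδ, h⟩
    · rintro ⟨J, ⟨hJ, hl⟩, δ, hδ, h⟩
      refine ⟨fun i => if i ∈ J then δ i else 0, fun i => ?_, ?_⟩
      · dsimp only
        split_ifs
        · exact hδ i
        · exact le_rfl
      · rw [h, ← Finset.sum_subset hJ]
        · refine Finset.sum_congr rfl fun i hi => ?_
          simp [hi]
        · intro i _ hi
          simp [hi]
  rw [this]
  exact Set.Finite.isClosed_biUnion (Set.toFinite _) fun J hJ => scCone_closed_of_li v J hJ.2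

lemma sc_dual_eq {n : ℕ} (f : (Fin n → ℝ) →ₗ[ℝ] ℝ) : ∃ d : Fin n → ℝ, ∀ y, f y = y ⬝ᵥ d := by
  refine ⟨fun i => f (Pi.single i 1), fun y => ?_⟩
  rw [LinearMap.pi_apply_eq_sum_univ f y]
  simp only [dotProduct, smul_eq_mul]
  refine Finset.sum_congr rfl fun i _ => ?_
  congr 2
  ext j
  simp [Pi.single_apply, eq_comm]

lemma sc_farkas {n m : ℕ} (v : Fin m → Fin n → ℝ) (T : Finset (Fin m)) (c : Fin n → ℝ)
    (hc : c ∉ scCone v T) : ∃ d : Fin n → ℝ, (∀ i ∈ T, 0 ≤ v i ⬝ᵥ d) ∧ c ⬝ᵥ d < 0 := by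
  have hconv : Convex ℝ (scCone v T) := by
    rintro x ⟨γ, hγ, rfl⟩ y ⟨δ, hδ, rfl⟩ p q hp hq _
    refine ⟨fun i => p * γ i + q * δ i,
      fun i => add_nonneg (mul_nonneg hp (hγ i)) (mul_nonneg hq (hδ i)), ?_⟩
    simp only [add_smul, mul_smul, Finset.sum_add_distrib, Finset.smul_sum]
  obtain ⟨f, u, hfu, hub⟩ := geometric_hahn_banach_point_closed hconv (scCone_closed v T) hc
  obtain ⟨d, hd⟩ := sc_dual_eq (f : (Fin n → ℝ) →ₗ[ℝ] ℝ)
  have hd' : ∀ y, f y = y ⬝ᵥ d := hd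
  have hu0 : u < 0 := by
    have := hub 0 ⟨0, by simp, by simp⟩
    simpa using this
  refine ⟨d, fun i hi => ?_, ?_⟩
  · rw [← hd']
    by_contra hneg
    push Not at hneg
    have := hub ((u / f (v i)) • v i) ⟨fun j => if j = i then u / f (v i) else 0, fun j => by
      dsimp only
      split_ifs
      · exact div_nonneg_of_nonpos hu0.le hneg.le
      · exact le_rfl, by simp [hi]⟩
    rw [map_smul, smul_eq_mul, div_mul_cancel₀ _ hneg.ne] at this
    exact lt_irrefl _ this
  · rw [← hd']; linarith

lemma sc_move {n m : ℕ} (a : Fin m → Fin n → ℝ) (b : Fin m → ℝ) (x d : Fin n → ℝ)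
    (hx : x ∈ Feas a b) (hd : ∀ i, a i ⬝ᵥ x = b i → 0 ≤ a i ⬝ᵥ d) :
    ∀ᶠ ε : ℝ in nhdsWithin 0 (Set.Ioi 0), x + ε • d ∈ Feas a b := by
  simp only [Feas, Set.mem_setOf_eq]
  rw [Filter.eventually_all]
  intro i
  simp only [dotProduct_add, dotProduct_smul, smul_eq_mul]
  by_cases h : a i ⬝ᵥ x = b i
  · filter_upwards [self_mem_nhdsWithin] with ε hε
    rw [h]
    have := mul_nonneg (le_of_lt (Set.mem_Ioi.1 hε)) (hd i h)
    linarith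
  · have hlt : b i < a i ⬝ᵥ x := lt_of_le_of_ne (hx i) (Ne.symm h)
    have hcont : Continuous fun ε : ℝ => a i ⬝ᵥ x + ε * (a i ⬝ᵥ d) := by fun_prop
    have : ∀ᶠ ε : ℝ in nhds 0, b i < a i ⬝ᵥ x + ε * (a i ⬝ᵥ d) :=
      hcont.continuousAt.eventually_const_lt (by simpa using hlt)
    exact (this.filter_mono nhdsWithin_le_nhds).mono fun _ h => h.le

lemma sc_main {n m : ℕ} (N : Seminorm ℝ (Fin n → ℝ)) (a : Fin m → Fin n → ℝ) (b : Fin m → ℝ)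
    (hne : (Feas a b).Nonempty) (hbdd : Bornology.IsBounded (Feas a b))
    (xh c : Fin n → ℝ) :
    ∃ xk ∈ OptSet a b c,
      N (xh - xk) = sSup ((fun x => N (xh - x)) '' OptSet a b c) ∧
      ∃ I : Finset (Fin m), I.card = n ∧
        (∀ i ∈ I, a i ⬝ᵥ xk = b i) ∧
        ∃ γ : Fin m → ℝ, (∀ i, 0 ≤ γ i) ∧ c = ∑ i ∈ I, γ i • a i := by
  classical
  have hcd : ∀ v : Fin n → ℝ, Continuous fun x : Fin n → ℝ => v ⬝ᵥ x := fun v => by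
    simp only [dotProduct]; fun_prop
  have hcl : IsClosed (Feas a b) := by
    simp only [Feas, Set.setOf_forall]
    exact isClosed_iInter fun i => isClosed_le continuous_const (hcd _)
  have hcomp : IsCompact (Feas a b) := Metric.isCompact_of_isClosed_isBounded hcl hbdd
  have hOne : (OptSet a b c).Nonempty := by
    obtain ⟨x, hx, hm⟩ := hcomp.exists_isMinOn hne (hcd c).continuousOn
    exact ⟨x, hx, fun y hy => hm hy⟩
  have hOcl : IsClosed (OptSet a b c) := by
    have : OptSet a b c = Feas a b ∩ ⋂ y ∈ Feas a b, {x | c ⬝ᵥ x ≤ c ⬝ᵥ y} := by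
      ext x; simp [OptSet]
    rw [this]
    exact hcl.inter (isClosed_biInter fun y _ => isClosed_le (hcd c) continuous_const)
  have hOcomp : IsCompact (OptSet a b c) := hcomp.of_isClosed_subset hOcl fun x hx => hx.1
  have hNc : Continuous N := by
    have hc : ConvexOn ℝ Set.univ N := N.convexOn
    exact continuousOn_univ.1 (hc.continuousOn isOpen_univ)
  have hfc : Continuous fun x => N (xh - x) := hNc.comp (by fun_prop)
  obtain ⟨z, hz, hzmax⟩ := hOcomp.exists_isMaxOn hOne hfc.continuousOn
  have hzmax' : ∀ x ∈ OptSet a b c, N (xh - x) ≤ N (xh - z) := fun x hx => hzmax hx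
  set M : Set (Fin n → ℝ) := {x ∈ OptSet a b c | N (xh - z) ≤ N (xh - x)} with hM
  have hMcomp : IsCompact M := by
    have : M = OptSet a b c ∩ {x | N (xh - z) ≤ N (xh - x)} := rfl
    rw [this]
    exact hOcomp.inter_right (isClosed_le continuous_const hfc)
  obtain ⟨x, hxM, hxext⟩ := hMcomp.extremePoints_nonempty ⟨z, hz, le_rfl⟩
  have key : ∀ d : Fin n → ℝ, x + d ∈ Feas a b → x - d ∈ Feas a b → d = 0 := by
    intro d h1 h2
    have hc1 := hxM.1.2 _ h1
    have hc2 := hxM.1.2 _ h2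
    simp only [dotProduct_add, dotProduct_sub] at hc1 hc2
    have hcd0 : c ⬝ᵥ d = 0 := by linarith
    have o1 : x + d ∈ OptSet a b c := ⟨h1, fun y hy => by
      rw [dotProduct_add, hcd0, add_zero]; exact hxM.1.2 y hy⟩
    have o2 : x - d ∈ OptSet a b c := ⟨h2, fun y hy => by
      rw [dotProduct_sub, hcd0, sub_zero]; exact hxM.1.2 y hy⟩
    have n1 := hzmax' _ o1
    have n2 := hzmax' _ o2
    have n3 : N (xh - x) + N (xh - x) ≤ N (xh - (x + d)) + N (xh - (x - d)) := by
      have := map_add_le_add N (xh - (x + d)) (xh - (x - d))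
      have e : (xh - (x + d)) + (xh - (x - d)) = (2 : ℝ) • (xh - x) := by
        rw [two_smul]; abel
      rw [e, map_smul_eq_mul] at this
      norm_num at this
      linarith
    have n4 := hxM.2
    have m1 : x + d ∈ M := ⟨o1, by linarith⟩
    have m2 : x - d ∈ M := ⟨o2, by linarith⟩
    have := hxext m1 m2 ⟨1 / 2, 1 / 2, by norm_num, by norm_num, by norm_num, by
      ext i; simp; ring⟩
    simpa using this
  have hxF : x ∈ Feas a b := hxM.1.1
  set T : Finset (Fin m) := Finset.univ.filter fun i => a i ⬝ᵥ x = b i with hT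
  have hTm : ∀ i, i ∈ T ↔ a i ⬝ᵥ x = b i := by simp [hT]
  have hspan : Submodule.span ℝ (a '' (T : Set (Fin m))) = ⊤ := by
    by_contra hns
    obtain ⟨f, hf0, hf⟩ := Submodule.exists_le_ker_of_lt_top _ (lt_top_iff_ne_top.2 hns)
    obtain ⟨d, hd⟩ := sc_dual_eq f
    have had : ∀ i, a i ⬝ᵥ x = b i → a i ⬝ᵥ d = 0 := fun i hi => by
      rw [← hd]
      exact hf (Submodule.subset_span ⟨i, by simpa using (hTm i).2 hi, rfl⟩)
    obtain ⟨ε, ⟨e1, e2⟩, e3⟩ := (((sc_move a b x d hxF fun i hi => (had i hi).ge).and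
      (sc_move a b x (-d) hxF fun i hi => by
        rw [dotProduct_neg, had i hi, neg_zero])).and self_mem_nhdsWithin).exists
    have h0 := key (ε • d) e1 (by rw [sub_eq_add_neg, ← smul_neg]; exact e2)
    have hd0 : d = 0 := (smul_eq_zero.1 h0).resolve_left (ne_of_gt e3)
    apply hf0
    ext y
    simp [hd, hd0]
  have hcone : c ∈ scCone a T := by
    by_contra hcn
    obtain ⟨d, hd1, hd2⟩ := sc_farkas a T c hcn
    obtain ⟨ε, e1, e3⟩ := ((sc_move a b x d hxF fun i hi => hd1 i ((hTm i).2 hi)).and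
      self_mem_nhdsWithin).exists
    have := hxM.1.2 _ e1
    rw [dotProduct_add, dotProduct_smul, smul_eq_mul] at this
    have h2 := mul_neg_of_pos_of_neg (Set.mem_Ioi.1 e3) hd2
    linarith
  obtain ⟨γ, hγ, hcγ⟩ := hcone
  obtain ⟨J, hJT, hJl, δ, hδ, hcδ⟩ := sc_carath a c T γ hγ hcγ
  obtain ⟨B, hBT, hJB, hsp, hBl⟩ := exists_linearIndepOn_extension hJl
    (Finset.coe_subset.2 hJT)
  have hBtop : Submodule.span ℝ (a '' B) = ⊤ := by
    rw [eq_top_iff, ← hspan]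
    exact Submodule.span_le.2 hsp
  have hBcard : B.toFinset.card = n := by
    have hb := Module.finrank_eq_card_basis (Module.Basis.mk hBl (by
      rw [show Set.range (fun i : B => a i) = a '' B by rw [Set.image_eq_range]]
      exact hBtop.ge))
    rw [Module.finrank_fin_fun] at hb
    rw [Set.toFinset_card]
    exact hb.symm
  refine ⟨x, hxM.1, ?_, B.toFinset, hBcard, fun i hi => (hTm i).1 ?_,
    fun i => if i ∈ J then δ i else 0, fun i => ?_, ?_⟩
  · have hg : IsGreatest ((fun x => N (xh - x)) '' OptSet a b c) (N (xh - x)) := by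
      refine ⟨⟨x, hxM.1, rfl⟩, ?_⟩
      rintro _ ⟨y, hy, rfl⟩
      exact (hzmax' y hy).trans hxM.2
    exact hg.csSup_eq.symm
  · exact Finset.mem_coe.1 (hBT (Set.mem_toFinset.1 hi))
  · dsimp only
    split_ifs
    · exact hδ i
    · exact le_rfl
  · have hJB' : J ⊆ B.toFinset := fun i hi => Set.mem_toFinset.2 (hJB (Finset.mem_coe.2 hi))
    rw [hcδ, ← Finset.sum_subset hJB']
    · refine Finset.sum_congr rfl fun i hi => ?_
      simp [hi]
    · intro i _ hi
      simp [hi]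

/-- **Theorem 1.** If the SC optimal value `ρ*` is attained by a cluster assignment `g*` and
`ℓ1`-normalized cost vectors `c*`, then for every `k` there is a point `x^{k*}` of
`X^{k*}(c^{g*(k)*})` farthest from the observation `x̂^k`, lying on `n` tight constraints indexed
by `I^{k*}`, with `c^{g*(k)*}` a conic combination of the rows `a^{ki}`, `i ∈ I^{k*}`. -/
theorem sc_solution_structure
    (n K L : ℕ) (hn : 1 ≤ n) (hK : 1 ≤ K) (hL : 1 ≤ L)
    (N : Seminorm ℝ (Fin n → ℝ)) (hN : ∀ x, N x = 0 → x = 0)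
    (m : Fin K → ℕ)
    (a : (k : Fin K) → Fin (m k) → Fin n → ℝ) (b : (k : Fin K) → Fin (m k) → ℝ)
    (hne : ∀ k, (Feas (a k) (b k)).Nonempty)
    (hbdd : ∀ k, Bornology.IsBounded (Feas (a k) (b k)))
    (xhat : Fin K → Fin n → ℝ)
    (gstar : Fin K → Fin L) (cstar : Fin L → Fin n → ℝ)
    (hcnorm : ∀ ℓ, ∑ j, |cstar ℓ j| = 1)
    (hattain : WDist N a b xhat gstar cstar = SCval K L N a b xhat) :
    ∀ k : Fin K, ∃ xk ∈ OptSet (a k) (b k) (cstar (gstar k)),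
      N (xhat k - xk) =
        sSup ((fun x => N (xhat k - x)) '' OptSet (a k) (b k) (cstar (gstar k))) ∧
      ∃ I : Finset (Fin (m k)), I.card = n ∧
        (∀ i ∈ I, a k i ⬝ᵥ xk = b k i) ∧
        ∃ γ : Fin (m k) → ℝ, (∀ i, 0 ≤ γ i) ∧
          cstar (gstar k) = ∑ i ∈ I, γ i • a k i := by
  intro k
  exact sc_main N (a k) (b k) (hne k) (hbdd k) (xhat k) (cstar (gstar k))
end

section
/- The optimal value β* of the lower-bound formulation SC-LB is at most the optimal value ρ* of the stability-driven clustering problem: β* ≤ ρ*. -/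
/- Proposition 2(i) of the paper: the SC-LB value β* is a lower bound on the SC value ρ*. -/

open scoped Matrix BigOperators

/-- The set of objective values of SC-LB-feasible tuples: a cluster assignment `g`,
`ℓ1`-normalized cost vectors `c`, and for each `k` a feasible point `x^k`, an index set `I^k`
of `n` constraints tight at `x^k`, and nonnegative coefficients `λ^k` expressing `c^{g(k)}` as a
conic combination of the selected rows; the objective is `max_k ‖x̂^k − x^k‖`. -/
noncomputable def SCLBobjSet {n : ℕ} (K L : ℕ) {m : Fin K → ℕ} (N : Seminorm ℝ (Fin n → ℝ))
    (a : (k : Fin K) → Fin (m k) → Fin n → ℝ) (b : (k : Fin K) → Fin (m k) → ℝ)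
    (xhat : Fin K → Fin n → ℝ) : Set ℝ :=
  {r : ℝ | ∃ (g : Fin K → Fin L) (c : Fin L → Fin n → ℝ)
      (x : (k : Fin K) → Fin n → ℝ) (I : (k : Fin K) → Finset (Fin (m k)))
      (lam : (k : Fin K) → Fin (m k) → ℝ),
    (∀ ℓ, ∑ j, |c ℓ j| = 1) ∧
    (∀ k, x k ∈ Feas (a k) (b k)) ∧
    (∀ k, (I k).card = n) ∧
    (∀ k, ∀ i ∈ I k, a k i ⬝ᵥ x k = b k i) ∧
    (∀ k, ∀ i ∈ I k, 0 ≤ lam k i) ∧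
    (∀ k, c (g k) = ∑ i ∈ I k, lam k i • a k i) ∧
    r = ⨆ k : Fin K, N (xhat k - x k)}

/-- The SC-LB value `β*`. -/
noncomputable def SCLBval {n : ℕ} (K L : ℕ) {m : Fin K → ℕ} (N : Seminorm ℝ (Fin n → ℝ))
    (a : (k : Fin K) → Fin (m k) → Fin n → ℝ) (b : (k : Fin K) → Fin (m k) → ℝ)
    (xhat : Fin K → Fin n → ℝ) : ℝ :=
  sInf (SCLBobjSet K L N a b xhat)

lemma cone_cara {ι E : Type*} [DecidableEq ι] [AddCommGroup E] [Module ℝ E] (v : ι → E)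
    (T : Finset ι) : ∀ lam : ι → ℝ, (∀ i ∈ T, 0 ≤ lam i) →
    ∃ S ⊆ T, LinearIndepOn ℝ v (S : Set ι) ∧ ∃ mu : ι → ℝ, (∀ i ∈ S, 0 ≤ mu i) ∧
      ∑ i ∈ S, mu i • v i = ∑ i ∈ T, lam i • v i := by
  induction T using Finset.strongInduction with
  | H T ih =>
    intro lam hlam
    by_cases hT : LinearIndepOn ℝ v (T : Set ι)
    · exact ⟨T, subset_rfl, hT, lam, hlam, rfl⟩
    have key : ∃ g : ι → ℝ, ∑ i ∈ T, g i • v i = 0 ∧ ∃ j ∈ T, 0 < g j := by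
      rw [linearIndepOn_finset_iff] at hT
      push Not at hT
      obtain ⟨g, hg, j, hj, hgj⟩ := hT
      rcases lt_or_gt_of_ne hgj with h | h
      · refine ⟨fun i => - g i, ?_, j, hj, by simpa using h⟩
        simp [hg]
      · exact ⟨g, hg, j, hj, h⟩
    obtain ⟨g, hg, j, hj, hgj⟩ := key
    obtain ⟨i0, hi0, hmin⟩ := Finset.exists_min_image (T.filter (fun i => 0 < g i))
      (fun i => lam i / g i) ⟨j, by simp [hj, hgj]⟩
    simp only [Finset.mem_filter] at hi0 hmin
    obtain ⟨hi0T, hg0⟩ := hi0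
    set t := lam i0 / g i0 with ht
    have ht0 : 0 ≤ t := div_nonneg (hlam _ hi0T) hg0.le
    have hnn : ∀ i ∈ T, 0 ≤ lam i - t * g i := by
      intro i hi
      by_cases h : 0 < g i
      · have := hmin i ⟨hi, h⟩
        rw [le_div_iff₀ h] at this
        linarith
      · have := mul_nonneg ht0 (neg_nonneg.2 (not_lt.1 h))
        have := hlam i hi
        nlinarith
    obtain ⟨S, hS, hli, mu, hmu, hsum⟩ := ih (T.erase i0) (Finset.erase_ssubset hi0T)
      (fun i => lam i - t * g i) (fun i hi => hnn i (Finset.mem_of_mem_erase hi))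
    refine ⟨S, hS.trans (Finset.erase_subset _ _), hli, mu, hmu, ?_⟩
    have h0 : lam i0 - t * g i0 = 0 := by rw [ht]; field_simp; ring
    rw [hsum, Finset.sum_erase _ (by simp [h0])]
    simp only [sub_smul, mul_smul, Finset.sum_sub_distrib, ← Finset.smul_sum, hg]
    simp

def coneSet {ι E : Type*} [AddCommGroup E] [Module ℝ E] (v : ι → E) (T : Finset ι) : Set E :=
  {y | ∃ lam : ι → ℝ, (∀ i ∈ T, 0 ≤ lam i) ∧ ∑ i ∈ T, lam i • v i = y}

lemma coneSet_closed_of_indep {ι : Type*} {n : ℕ} (v : ι → Fin n → ℝ)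
    (S : Finset ι) (h : LinearIndepOn ℝ v (S : Set ι)) : IsClosed (coneSet v S) := by
  classical
  let f := Fintype.linearCombination ℝ (fun i : S => v i)
  have hf : LinearMap.ker f = ⊥ := by
    rw [LinearMap.ker_eq_bot]
    exact LinearIndependent.fintypeLinearCombination_injective h
  have hc : IsClosed (f '' {w | ∀ i, 0 ≤ w i}) := by
    apply (LinearMap.isClosedEmbedding_of_injective hf).isClosedMap
    simp only [Set.setOf_forall]
    exact isClosed_iInter fun i => isClosed_le continuous_const (continuous_apply i)
  convert hc using 1
  ext y
  constructor
  · rintro ⟨lam, hl, rfl⟩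
    refine ⟨fun i => lam i, fun i => hl i i.2, ?_⟩
    simp only [f, Fintype.linearCombination_apply]
    exact Finset.sum_coe_sort S (fun i => lam i • v i)
  · rintro ⟨w, hw, rfl⟩
    refine ⟨fun i => if hi : i ∈ S then w ⟨i, hi⟩ else 0, fun i hi => by simpa [hi] using hw _, ?_⟩
    simp only [f, Fintype.linearCombination_apply]
    rw [← Finset.sum_coe_sort S]
    simp

lemma coneSet_closed {ι : Type*} {n : ℕ} (v : ι → Fin n → ℝ)
    (T : Finset ι) : IsClosed (coneSet v T) := by
  classical
  have : coneSet v T = ⋃ S ∈ {S : Finset ι | S ⊆ T ∧ LinearIndepOn ℝ v (S : Set ι)},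
      coneSet v S := by
    ext y
    simp only [Set.mem_iUnion, Set.mem_setOf_eq]
    constructor
    · rintro ⟨lam, hl, rfl⟩
      obtain ⟨S, hS, hli, mu, hmu, hs⟩ := cone_cara v T lam hl
      exact ⟨S, ⟨hS, hli⟩, mu, hmu, hs⟩
    · rintro ⟨S, ⟨hS, -⟩, mu, hmu, rfl⟩
      refine ⟨fun i => if i ∈ S then mu i else 0, fun i _ => ?_, ?_⟩
      · dsimp only
        split_ifs with h
        · exact hmu i h
        · exact le_rfl
      · simp only [ite_smul, zero_smul, Finset.sum_ite_mem, Finset.inter_eq_right.2 hS]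
  rw [this]
  apply Set.Finite.isClosed_biUnion
  · apply (T.powerset.finite_toSet).subset
    intro S hS
    simpa using hS.1
  · intro S hS
    exact coneSet_closed_of_indep v S hS.2

lemma coneSet_convex {ι : Type*} {n : ℕ} (v : ι → Fin n → ℝ)
    (T : Finset ι) : Convex ℝ (coneSet v T) := by
  rintro _ ⟨l, hl, rfl⟩ _ ⟨k, hk, rfl⟩ s t hs ht _
  refine ⟨fun i => s * l i + t * k i, fun i hi => ?_, ?_⟩
  · have := hl i hi
    have := hk i hi
    positivity
  · simp only [add_smul, mul_smul, Finset.sum_add_distrib, Finset.smul_sum]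

lemma strongDual_eq_dot {n : ℕ} (f : StrongDual ℝ (Fin n → ℝ)) :
    ∃ d : Fin n → ℝ, ∀ y, f y = y ⬝ᵥ d := by
  refine ⟨fun j => f (Pi.single j 1), fun y => ?_⟩
  conv_lhs => rw [pi_eq_sum_univ' y]
  simp [dotProduct, map_sum]

lemma my_farkas {ι : Type*} {n : ℕ} (v : ι → Fin n → ℝ) (T : Finset ι) (c : Fin n → ℝ)
    (h : ∀ d : Fin n → ℝ, (∀ i ∈ T, 0 ≤ v i ⬝ᵥ d) → 0 ≤ c ⬝ᵥ d) : c ∈ coneSet v T := by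
  classical
  by_contra hc
  obtain ⟨f, u, hu, hf⟩ := geometric_hahn_banach_point_closed (coneSet_convex v T)
    (coneSet_closed v T) hc
  obtain ⟨d, hd⟩ := strongDual_eq_dot f
  have h0 : u < 0 := by simpa using hf 0 ⟨0, by simp, by simp⟩
  have h1 := h d (fun i hi => by
    by_contra hneg
    push Not at hneg
    have h2 := hf ((u / (v i ⬝ᵥ d)) • v i) ⟨fun j => if j = i then u / (v i ⬝ᵥ d) else 0, by
      intro j _
      dsimp only
      split_ifs
      · exact (div_pos_of_neg_of_neg h0 hneg).le
      · exact le_rfl, by simp [hi]⟩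
    rw [map_smul, hd, smul_eq_mul, div_mul_cancel₀ _ hneg.ne] at h2
    exact lt_irrefl _ h2)
  rw [hd] at hu
  linarith

open Filter Topology in
lemma feas_dir {n m : ℕ} (a : Fin m → Fin n → ℝ) (b : Fin m → ℝ) (x d : Fin n → ℝ)
    (hx : x ∈ Feas a b) (hd : ∀ i, a i ⬝ᵥ x = b i → 0 ≤ a i ⬝ᵥ d) :
    ∀ᶠ e in 𝓝[>] (0 : ℝ), x + e • d ∈ Feas a b := by
  simp only [Feas, Set.mem_setOf_eq, eventually_all]
  intro i
  simp only [dotProduct_add, dotProduct_smul, smul_eq_mul]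
  by_cases h : a i ⬝ᵥ x = b i
  · filter_upwards [self_mem_nhdsWithin] with e he
    have := mul_nonneg (le_of_lt he) (hd i h)
    linarith
  · have hlt : b i < a i ⬝ᵥ x := lt_of_le_of_ne (hx i) (Ne.symm h)
    have ht : Tendsto (fun e : ℝ => a i ⬝ᵥ x + e * (a i ⬝ᵥ d)) (𝓝[>] 0) (𝓝 (a i ⬝ᵥ x)) := by
      have : Continuous (fun e : ℝ => a i ⬝ᵥ x + e * (a i ⬝ᵥ d)) := by fun_prop
      simpa using (this.tendsto 0).mono_left nhdsWithin_le_nhds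
    exact (ht.eventually (lt_mem_nhds hlt)).mono fun _ h => h.le

lemma cont_dot {n : ℕ} (c : Fin n → ℝ) : Continuous (fun x : Fin n → ℝ => c ⬝ᵥ x) := by
  unfold dotProduct; fun_prop

lemma feas_closed {n m : ℕ} (a : Fin m → Fin n → ℝ) (b : Fin m → ℝ) : IsClosed (Feas a b) := by
  simp only [Feas, Set.setOf_forall]
  exact isClosed_iInter fun i => isClosed_le continuous_const (cont_dot _)

lemma opt_compact {n m : ℕ} (a : Fin m → Fin n → ℝ) (b : Fin m → ℝ) (c : Fin n → ℝ)
    (hb : Bornology.IsBounded (Feas a b)) : IsCompact (OptSet a b c) := by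
  apply Metric.isCompact_of_isClosed_isBounded _ (hb.subset fun x hx => hx.1)
  have : OptSet a b c = Feas a b ∩ ⋂ y ∈ Feas a b, {x | c ⬝ᵥ x ≤ c ⬝ᵥ y} := by
    ext x; simp [OptSet]
  rw [this]
  exact (feas_closed a b).inter (isClosed_biInter fun y _ =>
    isClosed_le (cont_dot _) continuous_const)

lemma opt_nonempty {n m : ℕ} (a : Fin m → Fin n → ℝ) (b : Fin m → ℝ) (c : Fin n → ℝ)
    (hb : Bornology.IsBounded (Feas a b)) (hne : (Feas a b).Nonempty) :
    (OptSet a b c).Nonempty := by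
  obtain ⟨x, hx, hm⟩ := (Metric.isCompact_of_isClosed_isBounded (feas_closed a b) hb).exists_isMinOn
    hne (cont_dot c).continuousOn
  exact ⟨x, hx, fun y hy => hm hy⟩

open Filter Topology in
lemma exists_vertex {n m : ℕ} (a : Fin m → Fin n → ℝ) (b : Fin m → ℝ) (c : Fin n → ℝ)
    (hb : Bornology.IsBounded (Feas a b)) (hne : (Feas a b).Nonempty) :
    ∃ x ∈ OptSet a b c, ∃ (I : Finset (Fin m)) (lam : Fin m → ℝ), I.card = n ∧
      (∀ i ∈ I, a i ⬝ᵥ x = b i) ∧ (∀ i ∈ I, 0 ≤ lam i) ∧ c = ∑ i ∈ I, lam i • a i := by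
  classical
  obtain ⟨x, hx⟩ := (opt_compact a b c hb).extremePoints_nonempty (opt_nonempty a b c hb hne)
  rw [mem_extremePoints] at hx
  obtain ⟨hxo, hext⟩ := hx
  refine ⟨x, hxo, ?_⟩
  let T : Finset (Fin m) := Finset.univ.filter fun i => a i ⬝ᵥ x = b i
  have hT : ∀ i, i ∈ T ↔ a i ⬝ᵥ x = b i := by simp [T]
  have hfar : ∀ d : Fin n → ℝ, (∀ i ∈ T, 0 ≤ a i ⬝ᵥ d) → 0 ≤ c ⬝ᵥ d := by
    intro d hd
    obtain ⟨e, he, hpos⟩ := ((feas_dir a b x d hxo.1 fun i hi => hd i ((hT i).2 hi)).and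
      self_mem_nhdsWithin).exists
    have := hxo.2 _ he
    rw [dotProduct_add, dotProduct_smul, smul_eq_mul] at this
    exact nonneg_of_mul_nonneg_right (by linarith) hpos
  have horth : ∀ d : Fin n → ℝ, (∀ i ∈ T, a i ⬝ᵥ d = 0) → d = 0 := by
    intro d hd
    have h1 := hfar d fun i hi => (hd i hi).ge
    have h2 := hfar (-d) fun i hi => by simp [hd i hi]
    have h0 : c ⬝ᵥ d = 0 := by
      rw [dotProduct_neg] at h2; linarith
    obtain ⟨e, ⟨he1, he2⟩, hpos⟩ :=
      (((feas_dir a b x d hxo.1 fun i hi => (hd i ((hT i).2 hi)).ge).and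
      (feas_dir a b x (-d) hxo.1 fun i hi => by simp [hd i ((hT i).2 hi)])).and
      self_mem_nhdsWithin).exists
    have ho1 : x + e • d ∈ OptSet a b c := ⟨he1, fun y hy => by
      rw [dotProduct_add, dotProduct_smul, h0]; simpa using hxo.2 y hy⟩
    have ho2 : x + e • (-d) ∈ OptSet a b c := ⟨he2, fun y hy => by
      rw [dotProduct_add, dotProduct_smul, dotProduct_neg, h0]; simpa using hxo.2 y hy⟩
    have := (hext _ ho1 _ ho2 ⟨1/2, 1/2, by norm_num, by norm_num, by norm_num, by module⟩).1
    have h3 : e • d = 0 := by simpa using this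
    exact (smul_eq_zero.1 h3).resolve_left (ne_of_gt hpos)
  have hspan : Submodule.span ℝ (a '' (T : Set (Fin m))) = ⊤ := by
    by_contra hne
    obtain ⟨f, hf, hle⟩ := Submodule.exists_le_ker_of_lt_top _ (lt_top_iff_ne_top.2 hne)
    obtain ⟨d, hd⟩ := strongDual_eq_dot (LinearMap.toContinuousLinearMap f)
    have hd' : ∀ y, f y = y ⬝ᵥ d := hd
    apply hf
    have : d = 0 := horth d fun i hi => by
      rw [← hd']
      exact hle (Submodule.subset_span ⟨i, hi, rfl⟩)
    ext y
    simp [hd', this]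
  obtain ⟨lam, hlam, hsum⟩ := my_farkas a T c hfar
  obtain ⟨S, hST, hli, mu, hmu, hs⟩ := cone_cara a T lam hlam
  obtain ⟨B, hBT, hSB, hTB, hBli⟩ := exists_linearIndepOn_extension hli (Finset.coe_subset.2 hST)
  have hBfin : B.Finite := T.finite_toSet.subset hBT
  lift B to Finset (Fin m) using hBfin
  have hSB' : S ⊆ B := Finset.coe_subset.1 hSB
  refine ⟨B, fun i => if i ∈ S then mu i else 0, ?_, fun i hi => (hT i).1 (hBT hi), fun i _ => ?_, ?_⟩
  · have hBspan : Submodule.span ℝ (a '' (B : Set (Fin m))) = ⊤ := by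
      rw [eq_top_iff, ← hspan]
      exact Submodule.span_le.2 hTB
    have h1 := finrank_span_eq_card (R := ℝ) (b := fun i : B => a i) hBli
    have h2 : Set.range (fun i : B => a i) = a '' (B : Set (Fin m)) := by
      ext y; simp
    rw [h2, hBspan, finrank_top] at h1
    simpa using h1.symm
  · dsimp only
    split_ifs with h
    · exact hmu i h
    · exact le_rfl
  · simp only [ite_smul, zero_smul, Finset.sum_ite_mem, Finset.inter_eq_right.2 hSB']
    rw [hs, hsum]

/-- **Proposition 2(i).** The optimal value `β*` of the lower-bound formulation SC-LB is at most
the optimal value `ρ*` of the stability-driven clustering problem. -/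
theorem sclb_le_sc
    (n K L : ℕ) (hn : 1 ≤ n) (hK : 1 ≤ K) (hL : 1 ≤ L)
    (N : Seminorm ℝ (Fin n → ℝ)) (hN : ∀ x, N x = 0 → x = 0)
    (m : Fin K → ℕ)
    (a : (k : Fin K) → Fin (m k) → Fin n → ℝ) (b : (k : Fin K) → Fin (m k) → ℝ)
    (hne : ∀ k, (Feas (a k) (b k)).Nonempty)
    (hbdd : ∀ k, Bornology.IsBounded (Feas (a k) (b k)))
    (xhat : Fin K → Fin n → ℝ) :
    SCLBval K L N a b xhat ≤ SCval K L N a b xhat := by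
  have hNc : Continuous N :=
    continuousOn_univ.1 (N.convexOn.continuousOn isOpen_univ)
  have : Nonempty (Fin K) := ⟨⟨0, hK⟩⟩
  unfold SCLBval SCval
  apply le_csInf
  · refine ⟨_, fun _ => ⟨0, hL⟩, fun _ => Pi.single ⟨0, hn⟩ 1, fun _ => ?_, rfl⟩
    rw [Finset.sum_eq_single ⟨0, hn⟩] <;> simp +contextual
  · rintro r ⟨g, c, hc, rfl⟩
    choose x hx I lam hcard htight hlam hsum using
      fun k => exists_vertex (a k) (b k) (c (g k)) (hbdd k) (hne k)
    have hmem : (⨆ k, N (xhat k - x k)) ∈ SCLBobjSet K L N a b xhat :=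
      ⟨g, c, x, I, lam, hc, fun k => (hx k).1, hcard, htight, hlam, hsum, rfl⟩
    refine (csInf_le ⟨0, ?_⟩ hmem).trans ?_
    · rintro _ ⟨_, _, _, _, _, _, _, _, _, _, _, rfl⟩
      exact Real.iSup_nonneg fun k => apply_nonneg N _
    · unfold WDist
      refine ciSup_mono (Set.finite_range _).bddAbove fun k => ?_
      refine le_csSup ?_ ⟨x k, hx k, rfl⟩
      exact ((opt_compact _ _ _ (hbdd k)).image (by fun_prop)).bddAbove
end

section
/- Fix a constant α̂ > 0 and define the SC-UB value β*_UB as the infimum of max_{1≤k≤K} ‖x̂^k − x^k‖ over all SC-LB-feasible tuples whose coefficients additionally satisfy λ^k_i ≥ α̂ for every k and every i ∈ I^k. If β*_UB is attained by a tuple in which, for every k ∈ {1,…,K}, the selected rows {a^{ki} : i ∈ I^k} are linearly independent (the nondegeneracy implicit in the paper's proof), then ρ* ≤ β*_UB; i.e., the upper-bound formulation SC-UB yields an upper bound on the optimal value of the stability-driven clustering problem. -/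
/- Proposition 3 of the paper: the SC-UB value is an upper bound on the SC value ρ*. -/

open scoped Matrix BigOperators

/-- The set of objective values of SC-UB-feasible tuples: SC-LB-feasible tuples whose conic
coefficients additionally satisfy `λ^k_i ≥ α̂` for every `k` and every `i ∈ I^k`. -/
noncomputable def SCUBobjSet {n : ℕ} (K L : ℕ) {m : Fin K → ℕ} (N : Seminorm ℝ (Fin n → ℝ))
    (a : (k : Fin K) → Fin (m k) → Fin n → ℝ) (b : (k : Fin K) → Fin (m k) → ℝ)
    (xhat : Fin K → Fin n → ℝ) (alpha : ℝ) : Set ℝ :=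
  {r : ℝ | ∃ (g : Fin K → Fin L) (c : Fin L → Fin n → ℝ)
      (x : (k : Fin K) → Fin n → ℝ) (I : (k : Fin K) → Finset (Fin (m k)))
      (lam : (k : Fin K) → Fin (m k) → ℝ),
    (∀ ℓ, ∑ j, |c ℓ j| = 1) ∧
    (∀ k, x k ∈ Feas (a k) (b k)) ∧
    (∀ k, (I k).card = n) ∧
    (∀ k, ∀ i ∈ I k, a k i ⬝ᵥ x k = b k i) ∧
    (∀ k, ∀ i ∈ I k, alpha ≤ lam k i) ∧
    (∀ k, c (g k) = ∑ i ∈ I k, lam k i • a k i) ∧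
    r = ⨆ k : Fin K, N (xhat k - x k)}

/-- The SC-UB value `β*_UB` for the constant `α̂`. -/
noncomputable def SCUBval {n : ℕ} (K L : ℕ) {m : Fin K → ℕ} (N : Seminorm ℝ (Fin n → ℝ))
    (a : (k : Fin K) → Fin (m k) → Fin n → ℝ) (b : (k : Fin K) → Fin (m k) → ℝ)
    (xhat : Fin K → Fin n → ℝ) (alpha : ℝ) : ℝ :=
  sInf (SCUBobjSet K L N a b xhat alpha)

theorem optSet_eq_aux {n m : ℕ} (a : Fin m → Fin n → ℝ) (b : Fin m → ℝ) (c x : Fin n → ℝ)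
    (I : Finset (Fin m)) (lam : Fin m → ℝ) (alpha : ℝ) (halpha : 0 < alpha)
    (hx : x ∈ Feas a b) (hcard : I.card = n) (htight : ∀ i ∈ I, a i ⬝ᵥ x = b i)
    (hlam : ∀ i ∈ I, alpha ≤ lam i) (hc : c = ∑ i ∈ I, lam i • a i)
    (hli : LinearIndependent ℝ (fun i : I => a i)) : OptSet a b c = {x} := by
  have hdot : ∀ y, c ⬝ᵥ y = ∑ i ∈ I, lam i * (a i ⬝ᵥ y) := by
    intro y
    rw [hc, sum_dotProduct]
    simp [smul_dotProduct]
  have hdiff : ∀ y, c ⬝ᵥ y - c ⬝ᵥ x = ∑ i ∈ I, lam i * (a i ⬝ᵥ y - b i) := by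
    intro y
    rw [hdot, hdot, ← Finset.sum_sub_distrib]
    refine Finset.sum_congr rfl fun i hi => ?_
    rw [htight i hi]; ring
  have hterm : ∀ y ∈ Feas a b, ∀ i ∈ I, 0 ≤ lam i * (a i ⬝ᵥ y - b i) := by
    intro y hy i hi
    exact mul_nonneg (halpha.le.trans (hlam i hi)) (sub_nonneg.2 (hy i))
  have hopt : ∀ y ∈ Feas a b, c ⬝ᵥ x ≤ c ⬝ᵥ y := by
    intro y hy
    have := Finset.sum_nonneg (hterm y hy)
    rw [← hdiff] at this
    linarith
  ext y
  simp only [Set.mem_singleton_iff]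
  constructor
  · rintro ⟨hy, hy2⟩
    have h0 : ∑ i ∈ I, lam i * (a i ⬝ᵥ y - b i) = 0 := by
      rw [← hdiff]
      linarith [hopt y hy, hy2 x hx]
    have h1 := (Finset.sum_eq_zero_iff_of_nonneg (hterm y hy)).1 h0
    have h2 : ∀ i ∈ I, a i ⬝ᵥ (y - x) = 0 := by
      intro i hi
      rcases mul_eq_zero.1 (h1 i hi) with h | h
      · linarith [hlam i hi]
      · rw [dotProduct_sub, htight i hi, h]
    have hspan : Submodule.span ℝ (Set.range (fun i : I => a i)) = ⊤ :=
      hli.span_eq_top_of_card_eq_finrank' (by simp [hcard])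
    have h3 : ∀ v : Fin n → ℝ, v ⬝ᵥ (y - x) = 0 := by
      intro v
      have hv : v ∈ Submodule.span ℝ (Set.range (fun i : I => a i)) := by
        rw [hspan]; trivial
      induction hv using Submodule.span_induction with
      | mem v hv => obtain ⟨i, rfl⟩ := hv; exact h2 i i.2
      | zero => simp
      | add u v _ _ hu hv => rw [add_dotProduct, hu, hv, add_zero]
      | smul r v _ hv => rw [smul_dotProduct, hv, smul_zero]
    exact sub_eq_zero.1 (dotProduct_self_eq_zero.1 (h3 _))
  · rintro rfl
    exact ⟨hx, hopt⟩

/-- **Proposition 3.** Fix `α̂ > 0`. If the SC-UB value `β*_UB` is attained by a feasible tuple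
in which, for every `k`, the selected rows `{a^{ki} : i ∈ I^k}` are linearly independent (the
nondegeneracy implicit in the paper's proof), then `ρ* ≤ β*_UB`. -/
theorem sc_le_scub
    (n K L : ℕ) (hn : 1 ≤ n) (hK : 1 ≤ K) (hL : 1 ≤ L)
    (N : Seminorm ℝ (Fin n → ℝ)) (hN : ∀ x, N x = 0 → x = 0)
    (m : Fin K → ℕ)
    (a : (k : Fin K) → Fin (m k) → Fin n → ℝ) (b : (k : Fin K) → Fin (m k) → ℝ)
    (hne : ∀ k, (Feas (a k) (b k)).Nonempty)
    (hbdd : ∀ k, Bornology.IsBounded (Feas (a k) (b k)))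
    (xhat : Fin K → Fin n → ℝ)
    (alpha : ℝ) (halpha : 0 < alpha)
    (hattain : ∃ (g : Fin K → Fin L) (c : Fin L → Fin n → ℝ)
        (x : (k : Fin K) → Fin n → ℝ) (I : (k : Fin K) → Finset (Fin (m k)))
        (lam : (k : Fin K) → Fin (m k) → ℝ),
      (∀ ℓ, ∑ j, |c ℓ j| = 1) ∧
      (∀ k, x k ∈ Feas (a k) (b k)) ∧
      (∀ k, (I k).card = n) ∧
      (∀ k, ∀ i ∈ I k, a k i ⬝ᵥ x k = b k i) ∧
      (∀ k, ∀ i ∈ I k, alpha ≤ lam k i) ∧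
      (∀ k, c (g k) = ∑ i ∈ I k, lam k i • a k i) ∧
      (∀ k, LinearIndependent ℝ (fun i : (I k : Finset (Fin (m k))) => a k i)) ∧
      (⨆ k : Fin K, N (xhat k - x k)) = SCUBval K L N a b xhat alpha) :
    SCval K L N a b xhat ≤ SCUBval K L N a b xhat alpha := by
  obtain ⟨g, c, x, I, lam, hc1, hx, hcard, htight, hlam, hc, hli, hval⟩ := hattain
  rw [← hval]
  refine csInf_le ⟨0, ?_⟩ ⟨g, c, hc1, ?_⟩
  · rintro r ⟨g, c, -, rfl⟩
    refine Real.iSup_nonneg fun k => Real.sSup_nonneg ?_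
    rintro _ ⟨y, -, rfl⟩
    exact apply_nonneg N _
  · unfold WDist
    congr 1
    funext k
    rw [optSet_eq_aux (a k) (b k) (c (g k)) (x k) (I k) (lam k) alpha halpha (hx k) (hcard k)
      (htight k) (hlam k) (hc k) (hli k)]
    simp
end
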